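/- The map sending a noncrossing perfect matching M of Fin (2n) to the function w : Fin (2n) → Bool defined by w i = true if and only if i is the smaller element of its pair in M, is a bijection from the set of noncrossing perfect matchings of Fin (2n) onto the set of ballot sequences of length 2n, and its inverse sends a ballot sequence to its Catalan matching. -/

import Mathlib

def IsBallot (n : ℕ) (w : Fin (2 * n) → Bool) : Prop :=
  (Finset.univ.filter fun i => w i = true).card = n ∧
    ∀ m : ℕ, m ≤ 2 * n →
      (Finset.univ.filter fun i : Fin (2 * n) => i.val < m ∧ w i = true).card ≥
        (Finset.univ.filter fun i : Fin (2 * n) => i.val < m ∧ w i = false).card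

def IsPerfectMatching (n : ℕ) (M : Finset (Finset (Fin (2 * n)))) : Prop :=
  (∀ p ∈ M, p.card = 2) ∧ ∀ i : Fin (2 * n), ∃! p, p ∈ M ∧ i ∈ p

def IsNoncrossing (n : ℕ) (M : Finset (Finset (Fin (2 * n)))) : Prop :=
  ¬ ∃ i k j l : Fin (2 * n), i < k ∧ k < j ∧ j < l ∧
      ({i, j} : Finset (Fin (2 * n))) ∈ M ∧ ({k, l} : Finset (Fin (2 * n))) ∈ M

def IsCatalanMatching (n : ℕ) (w : Fin (2 * n) → Bool)
    (M : Finset (Finset (Fin (2 * n)))) : Prop :=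
  IsPerfectMatching n M ∧ IsNoncrossing n M ∧
    ∀ i j : Fin (2 * n), i < j → ({i, j} : Finset (Fin (2 * n))) ∈ M →
      w i = true ∧ w j = false

/-- The word of a matching: `i` is sent to `true` iff `i` is the smaller element of
its pair. -/
def matchingWord (n : ℕ) (M : Finset (Finset (Fin (2 * n)))) : Fin (2 * n) → Bool :=
  fun i => decide (∃ j : Fin (2 * n), i < j ∧ ({i, j} : Finset (Fin (2 * n))) ∈ M)

theorem IsPerfectMatching.exists_partner {n : ℕ} {M : Finset (Finset (Fin (2 * n)))}
    (hM : IsPerfectMatching n M) :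
    ∃ f : Fin (2 * n) → Fin (2 * n), (∀ i, f i ≠ i) ∧ (∀ i, f (f i) = i) ∧
      ∀ i j, ({i, j} : Finset (Fin (2 * n))) ∈ M ↔ f i = j := by
  have hne : ∀ i j, ({i, j} : Finset (Fin (2 * n))) ∈ M → j ≠ i := by
    rintro i j h rfl
    simpa using hM.1 _ h
  have hex : ∀ i, ∃ j, ({i, j} : Finset (Fin (2 * n))) ∈ M := by
    intro i
    obtain ⟨p, ⟨hp, hi⟩, -⟩ := hM.2 i
    obtain ⟨a, b, -, rfl⟩ := Finset.card_eq_two.mp (hM.1 p hp)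
    rcases Finset.mem_insert.mp hi with rfl | hi
    · exact ⟨b, hp⟩
    · rw [Finset.mem_singleton] at hi
      subst hi
      exact ⟨a, by rwa [Finset.pair_comm]⟩
  have huniq : ∀ i j k, ({i, j} : Finset (Fin (2 * n))) ∈ M →
      ({i, k} : Finset (Fin (2 * n))) ∈ M → j = k := by
    intro i j k hj hk
    have h := (hM.2 i).unique ⟨hj, by simp⟩ ⟨hk, by simp⟩
    have hjk : j ∈ ({i, k} : Finset (Fin (2 * n))) := h ▸ by simp
    simpa [hne i j hj] using hjk
  choose f hf using hex
  refine ⟨f, fun i => hne _ _ (hf i), fun i => ?_, fun i j => ⟨fun h => huniq _ _ _ (hf i) h, ?_⟩⟩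
  · exact huniq _ _ _ (hf (f i)) (by rw [Finset.pair_comm]; exact hf i)
  · rintro rfl
    exact hf i

theorem IsPerfectMatching.subset_of_pairs {n : ℕ} {M M' : Finset (Finset (Fin (2 * n)))}
    (hM : IsPerfectMatching n M)
    (h : ∀ i j : Fin (2 * n), i < j → ({i, j} : Finset (Fin (2 * n))) ∈ M →
      ({i, j} : Finset (Fin (2 * n))) ∈ M') : M ⊆ M' := by
  intro p hp
  obtain ⟨a, b, hab, rfl⟩ := Finset.card_eq_two.mp (hM.1 p hp)
  rcases lt_or_gt_of_ne hab with hlt | hlt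
  · exact h a b hlt hp
  · rw [Finset.pair_comm] at hp ⊢
    exact h b a hlt hp

theorem matchingWord_eq_decide_lt {n : ℕ} {M : Finset (Finset (Fin (2 * n)))}
    {f : Fin (2 * n) → Fin (2 * n)}
    (hf : ∀ i j, ({i, j} : Finset (Fin (2 * n))) ∈ M ↔ f i = j) (i : Fin (2 * n)) :
    matchingWord n M i = decide (i < f i) := by
  simp [matchingWord, hf]

theorem IsCatalanMatching.matchingWord_eq {n : ℕ} {w : Fin (2 * n) → Bool}
    {M : Finset (Finset (Fin (2 * n)))} (hM : IsCatalanMatching n w M) :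
    matchingWord n M = w := by
  obtain ⟨hp, -, hw⟩ := hM
  obtain ⟨f, hne, hinv, hf⟩ := hp.exists_partner
  funext i
  rw [matchingWord_eq_decide_lt hf]
  rcases lt_or_gt_of_ne (hne i) with h | h
  · rw [(hw (f i) i h ((hf _ _).2 (hinv i))).2]
    simpa using h.le
  · rw [(hw i (f i) h ((hf _ _).2 rfl)).1]
    simpa using h

theorem isBallot_matchingWord {n : ℕ} {M : Finset (Finset (Fin (2 * n)))}
    (hM : IsPerfectMatching n M) : IsBallot n (matchingWord n M) := by
  obtain ⟨f, hne, hinv, hf⟩ := hM.exists_partner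
  have hinj : Function.Injective f := Function.LeftInverse.injective hinv
  have htrue : ∀ i, matchingWord n M i = true ↔ i < f i := by
    simp [matchingWord_eq_decide_lt hf]
  have hfalse : ∀ i, matchingWord n M i = false ↔ f i < i := fun i => by
    rw [matchingWord_eq_decide_lt hf, decide_eq_false_iff_not, not_lt]
    exact ⟨fun h => lt_of_le_of_ne h (hne i), le_of_lt⟩
  refine ⟨?_, fun m _ => ?_⟩
  · have hcard : (Finset.univ.filter fun i => matchingWord n M i = true).card =
        (Finset.univ.filter fun i => matchingWord n M i = false).card := by
      refine Finset.card_bij (fun i _ => f i) ?_ (fun _ _ _ _ h => hinj h) ?_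
      · intro i hi
        simpa only [htrue, hfalse, hinv, Finset.mem_filter_univ] using hi
      · intro i hi
        refine ⟨f i, ?_, hinv i⟩
        simpa only [htrue, hfalse, hinv, Finset.mem_filter_univ] using hi
    have hsum := Finset.card_filter_add_card_filter_not (s := Finset.univ)
      (fun i => matchingWord n M i = true)
    rw [Finset.card_univ, Fintype.card_fin] at hsum
    simp only [Bool.not_eq_true] at hsum
    omega
  · refine Finset.card_le_card_of_injOn f ?_ hinj.injOn
    intro i hi
    simp only [htrue, hfalse, hinv, Finset.coe_filter, Finset.mem_univ, true_and,
      Set.mem_ofPred_eq] at hi ⊢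
    exact ⟨lt_trans hi.2 hi.1, hi.2⟩

theorem pair_mem_of_matchingWord_eq {n : ℕ} {M M' : Finset (Finset (Fin (2 * n)))}
    (hM : IsPerfectMatching n M) (hc : IsNoncrossing n M)
    (hM' : IsPerfectMatching n M') (hc' : IsNoncrossing n M')
    (hw : matchingWord n M = matchingWord n M') (i j : Fin (2 * n)) (hij : i < j)
    (h : ({i, j} : Finset (Fin (2 * n))) ∈ M) : ({i, j} : Finset (Fin (2 * n))) ∈ M' := by
  obtain ⟨f, hne, hinv, hf⟩ := hM.exists_partner
  obtain ⟨g, hne', hinv', hg⟩ := hM'.exists_partner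
  have hword : ∀ i, i < f i ↔ i < g i := fun i => by
    have := congrFun hw i
    rwa [matchingWord_eq_decide_lt hf, matchingWord_eq_decide_lt hg, decide_eq_decide] at this
  have hcf : ∀ i k, i < k → k < f i → f i < f k → False := fun i k h₁ h₂ h₃ =>
    hc ⟨i, k, f i, f k, h₁, h₂, h₃, (hf _ _).2 rfl, (hf _ _).2 rfl⟩
  have hcg : ∀ i k, i < k → k < g i → g i < g k → False := fun i k h₁ h₂ h₃ =>
    hc' ⟨i, k, g i, g k, h₁, h₂, h₃, (hg _ _).2 rfl, (hg _ _).2 rfl⟩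
  rw [hf] at h
  rw [hg]
  induction hd : j.val - i.val using Nat.strong_induction_on generalizing i j with
  | _ d ih =>
    subst h
    have hi : i < g i := (hword i).1 hij
    rcases lt_trichotomy (g i) (f i) with hlt | heq | hgt
    · exfalso
      have h₁ : f (g i) < g i := by
        have := hword (g i)
        rw [hinv'] at this
        have := hne (g i)
        grind
      have h₂ : i < f (g i) := by
        have := hcf (f (g i)) i
        have := hinv (g i)
        have := hinv i
        grind
      have := ih _ (by omega) (f (g i)) (g i) h₁ (hinv _) rfl
      have := hinv' i
      grind
    · exact heq
    · exfalso
      have h₁ : g (f i) < f i := by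
        have := hword (f i)
        rw [hinv] at this
        have := hne' (f i)
        grind
      have h₂ : i < g (f i) := by
        have := hcg (g (f i)) i
        have := hinv' (f i)
        have := hinv' i
        grind
      have h₃ : g (f i) < f (g (f i)) := (hword _).2 (by rwa [hinv'])
      have h₄ : f (g (f i)) < f i := by
        have := hcf i (g (f i))
        have := hinv (g (f i))
        have := hinv i
        grind
      have := ih _ (by omega) (g (f i)) (f (g (f i))) h₃ rfl rfl
      have := hinv' (f i)
      grind

/-- The number of `i < m` with `w i = true` minus the number with `w i = false`. -/
def wordHeight {n : ℕ} (w : Fin (2 * n) → Bool) (m : ℕ) : ℤ :=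
  ((Finset.univ.filter fun i : Fin (2 * n) => i.val < m ∧ w i = true).card : ℤ) -
    (Finset.univ.filter fun i : Fin (2 * n) => i.val < m ∧ w i = false).card

theorem card_filter_lt_succ {n : ℕ} (w : Fin (2 * n) → Bool) (i : Fin (2 * n)) (b : Bool) :
    (Finset.univ.filter fun k : Fin (2 * n) => k.val < i.val + 1 ∧ w k = b).card =
      (Finset.univ.filter fun k : Fin (2 * n) => k.val < i.val ∧ w k = b).card +
        if w i = b then 1 else 0 := by
  split_ifs with h
  · rw [← Finset.card_insert_of_notMem (a := i) (by simp)]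
    congr 1
    ext k
    simp only [Finset.mem_filter, Finset.mem_univ, true_and, Finset.mem_insert, Fin.ext_iff]
    grind
  · simp only [add_zero]
    refine congrArg Finset.card (Finset.ext fun k => ?_)
    simp only [Finset.mem_filter, Finset.mem_univ, true_and]
    grind

theorem wordHeight_succ {n : ℕ} (w : Fin (2 * n) → Bool) (i : Fin (2 * n)) :
    wordHeight w (i.val + 1) = wordHeight w i.val + if w i = true then 1 else -1 := by
  unfold wordHeight
  rw [card_filter_lt_succ, card_filter_lt_succ]
  cases w i <;> simp <;> ring

theorem wordHeight_zero {n : ℕ} (w : Fin (2 * n) → Bool) : wordHeight w 0 = 0 := by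
  simp [wordHeight]

theorem IsBallot.wordHeight_nonneg {n : ℕ} {w : Fin (2 * n) → Bool} (hw : IsBallot n w)
    {m : ℕ} (hm : m ≤ 2 * n) : 0 ≤ wordHeight w m := by
  have := hw.2 m hm
  unfold wordHeight
  omega

theorem IsBallot.wordHeight_two_mul {n : ℕ} {w : Fin (2 * n) → Bool} (hw : IsBallot n w) :
    wordHeight w (2 * n) = 0 := by
  have hsum := Finset.card_filter_add_card_filter_not (s := Finset.univ) (fun i => w i = true)
  rw [Finset.card_univ, Fintype.card_fin, hw.1] at hsum
  simp only [Bool.not_eq_true] at hsum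
  simp only [wordHeight, Fin.is_lt, true_and, hw.1]
  omega

/-- `i < j` are the ends of an excursion of the height function of `w` above its value at `i`. -/
def IsExcursion {n : ℕ} (w : Fin (2 * n) → Bool) (i j : Fin (2 * n)) : Prop :=
  i < j ∧ wordHeight w (j.val + 1) = wordHeight w i.val ∧
    ∀ m : ℕ, i.val < m → m ≤ j.val → wordHeight w i.val < wordHeight w m

theorem IsExcursion.right_unique {n : ℕ} {w : Fin (2 * n) → Bool} {i j k : Fin (2 * n)}
    (hj : IsExcursion w i j) (hk : IsExcursion w i k) : j = k := by
  obtain ⟨h₁, h₂, h₃⟩ := hj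
  obtain ⟨h₄, h₅, h₆⟩ := hk
  have := h₃ (k.val + 1)
  have := h₆ (j.val + 1)
  grind

theorem IsExcursion.left_unique {n : ℕ} {w : Fin (2 * n) → Bool} {i j k : Fin (2 * n)}
    (hi : IsExcursion w i k) (hj : IsExcursion w j k) : i = j := by
  obtain ⟨h₁, h₂, h₃⟩ := hi
  obtain ⟨h₄, h₅, h₆⟩ := hj
  have := h₃ j.val
  have := h₆ i.val
  grind

theorem IsExcursion.apply_eq {n : ℕ} {w : Fin (2 * n) → Bool} {i j : Fin (2 * n)}
    (h : IsExcursion w i j) : w i = true ∧ w j = false := by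
  obtain ⟨h₁, h₂, h₃⟩ := h
  have := h₃ (i.val + 1)
  have := h₃ j.val
  have := wordHeight_succ w i
  have := wordHeight_succ w j
  grind

theorem IsBallot.exists_isExcursion_right {n : ℕ} {w : Fin (2 * n) → Bool} (hw : IsBallot n w)
    {i : Fin (2 * n)} (hi : w i = true) : ∃ j, IsExcursion w i j := by
  have hex : ∃ j : ℕ, i.val ≤ j ∧ wordHeight w (j + 1) ≤ wordHeight w i.val := by
    refine ⟨2 * n - 1, by omega, ?_⟩
    rw [Nat.sub_add_cancel (by have := i.isLt; omega), hw.wordHeight_two_mul]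
    exact hw.wordHeight_nonneg i.isLt.le
  classical
  obtain ⟨hle, hH⟩ := Nat.find_spec hex
  have hmin := fun m => Nat.find_min' hex (m := m)
  set j := Nat.find hex
  have hjlt : j < 2 * n := by
    have := hmin (2 * n - 1) ⟨by omega, by
      rw [Nat.sub_add_cancel (by have := i.isLt; omega), hw.wordHeight_two_mul]
      exact hw.wordHeight_nonneg i.isLt.le⟩
    have := i.isLt
    omega
  have hup : ∀ m : ℕ, i.val < m → m ≤ j → wordHeight w i.val < wordHeight w m := by
    intro m h₁ h₂
    by_contra! h
    have := hmin (m - 1) ⟨by omega, by rwa [Nat.sub_add_cancel (by omega)]⟩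
    omega
  have hsi := wordHeight_succ w i
  have hsj := wordHeight_succ w ⟨j, hjlt⟩
  have hij : i.val < j := by
    rcases hle.lt_or_eq with h | h
    · exact h
    · grind
  have := hup j hij le_rfl
  exact ⟨⟨j, hjlt⟩, hij, by grind, hup⟩

theorem IsBallot.exists_isExcursion_left {n : ℕ} {w : Fin (2 * n) → Bool} (hw : IsBallot n w)
    {j : Fin (2 * n)} (hj : w j = false) : ∃ i, IsExcursion w i j := by
  classical
  have h0 : wordHeight w 0 ≤ wordHeight w (j.val + 1) := by
    rw [wordHeight_zero]
    exact hw.wordHeight_nonneg j.isLt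
  have hH := Nat.findGreatest_spec (P := fun i => wordHeight w i ≤ wordHeight w (j.val + 1))
    (Nat.zero_le j.val) h0
  have hle := Nat.findGreatest_le (P := fun i => wordHeight w i ≤ wordHeight w (j.val + 1)) j.val
  have hmax := fun m => Nat.findGreatest_is_greatest
    (P := fun i => wordHeight w i ≤ wordHeight w (j.val + 1)) (n := j.val) (k := m)
  set i := Nat.findGreatest (fun i => wordHeight w i ≤ wordHeight w (j.val + 1)) j.val
  have hilt : i < 2 * n := hle.trans_lt j.isLt
  have hsi := wordHeight_succ w ⟨i, hilt⟩
  have hsj := wordHeight_succ w j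
  have hij : i < j.val := by
    rcases hle.lt_or_eq with h | h
    · exact h
    · grind
  have hup : ∀ m : ℕ, i < m → m ≤ j.val → wordHeight w (j.val + 1) < wordHeight w m :=
    fun m h₁ h₂ => not_le.mp (hmax m h₁ h₂)
  have h₁ := hup (i + 1) (by omega) (by omega)
  have heq : wordHeight w (j.val + 1) = wordHeight w i := by grind
  exact ⟨⟨i, hilt⟩, hij, heq, by rwa [heq] at hup⟩

theorem IsBallot.exists_isCatalanMatching {n : ℕ} {w : Fin (2 * n) → Bool} (hw : IsBallot n w) :
    ∃ M, IsCatalanMatching n w M := by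
  classical
  let M : Finset (Finset (Fin (2 * n))) :=
    Finset.univ.filter fun p => ∃ i j, IsExcursion w i j ∧ p = {i, j}
  have hmem : ∀ p, p ∈ M ↔ ∃ i j, IsExcursion w i j ∧ p = {i, j} := by simp [M]
  have hpair : ∀ i j : Fin (2 * n), i < j → ({i, j} : Finset (Fin (2 * n))) ∈ M →
      IsExcursion w i j := by
    intro i j hij h
    obtain ⟨a, b, hab, heq⟩ := (hmem _).1 h
    have hlt := hab.1
    have hi : i ∈ ({a, b} : Finset (Fin (2 * n))) := heq ▸ by simp
    have hj : j ∈ ({a, b} : Finset (Fin (2 * n))) := heq ▸ by simp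
    simp only [Finset.mem_insert, Finset.mem_singleton] at hi hj
    grind
  refine ⟨M, ⟨fun p hp => ?_, fun i => ?_⟩, ?_, fun i j hij h => (hpair i j hij h).apply_eq⟩
  · obtain ⟨i, j, hij, rfl⟩ := (hmem p).1 hp
    exact Finset.card_pair hij.1.ne
  · have huniq : ∀ a b c d, IsExcursion w a b → IsExcursion w c d →
        i ∈ ({a, b} : Finset (Fin (2 * n))) → i ∈ ({c, d} : Finset (Fin (2 * n))) →
        ({a, b} : Finset (Fin (2 * n))) = {c, d} := by
      intro a b c d hab hcd h₁ h₂
      have := hab.apply_eq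
      have := hcd.apply_eq
      simp only [Finset.mem_insert, Finset.mem_singleton] at h₁ h₂
      rcases h₁ with rfl | rfl <;> rcases h₂ with rfl | rfl
      · rw [hab.right_unique hcd]
      · grind
      · grind
      · rw [hab.left_unique hcd]
    have hex : ∃ a b, IsExcursion w a b ∧ i ∈ ({a, b} : Finset (Fin (2 * n))) := by
      cases h : w i
      · obtain ⟨a, ha⟩ := hw.exists_isExcursion_left h
        exact ⟨a, i, ha, by simp⟩
      · obtain ⟨b, hb⟩ := hw.exists_isExcursion_right h
        exact ⟨i, b, hb, by simp⟩
    obtain ⟨a, b, hab, hi⟩ := hex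
    refine ⟨{a, b}, ⟨(hmem _).2 ⟨a, b, hab, rfl⟩, hi⟩, ?_⟩
    rintro q ⟨hq, hiq⟩
    obtain ⟨c, d, hcd, rfl⟩ := (hmem q).1 hq
    exact huniq c d a b hcd hab hiq hi
  · rintro ⟨i, k, j, l, hik, hkj, hjl, h₁, h₂⟩
    obtain ⟨-, h₃, h₄⟩ := hpair i j (hik.trans hkj) h₁
    obtain ⟨-, -, h₅⟩ := hpair k l (hkj.trans hjl) h₂
    have := h₄ k.val hik hkj.le
    have := h₅ (j.val + 1) (by omega) (by omega)
    omega

/-- The matching-to-word map is a bijection from noncrossing perfect matchings of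
`Fin (2n)` onto ballot sequences of length `2n`, with inverse sending a ballot
sequence to its Catalan matching. -/
theorem matchingWord_bijOn (n : ℕ) :
    Set.BijOn (matchingWord n)
      {M : Finset (Finset (Fin (2 * n))) | IsPerfectMatching n M ∧ IsNoncrossing n M}
      {w : Fin (2 * n) → Bool | IsBallot n w} ∧
    ∀ w : Fin (2 * n) → Bool, IsBallot n w →
      ∀ M : Finset (Finset (Fin (2 * n))), IsCatalanMatching n w M →
        matchingWord n M = w := by
  refine ⟨⟨fun M hM => isBallot_matchingWord hM.1, ?_, fun w hw => ?_⟩,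
    fun w _ M hM => hM.matchingWord_eq⟩
  · rintro M ⟨hM, hc⟩ M' ⟨hM', hc'⟩ hw
    exact Finset.Subset.antisymm
      (hM.subset_of_pairs (pair_mem_of_matchingWord_eq hM hc hM' hc' hw))
      (hM'.subset_of_pairs (pair_mem_of_matchingWord_eq hM' hc' hM hc hw.symm))
  · obtain ⟨M, hM⟩ := hw.exists_isCatalanMatching
    exact ⟨M, ⟨hM.1, hM.2.1⟩, hM.matchingWord_eq⟩
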